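/- Let A be a real m×m symmetric positive semidefinite matrix and B real m×m skew-symmetric with A - iB positive semidefinite, and let A', B' be their normal forms: A' = diag(I_a, 0) and B' with blocks [[0,μ],[-μ,0]] padded by zeros, obtained by a congruence A' = CAC^T, B' = CBC^T, where a = rank A, b = rank B, and μ = diag(μ_1,...,μ_{b/2}) with 0 < μ_j ≤ 1. Then rank(A - iB) = a - #₁(μ), where #₁(μ) is the number of μ_j equal to 1. -/

import Mathlib

open Matrix Complex ComplexOrder

/-- The normal form as a block matrix, factored as `L * D * U`. -/
lemma nf_factor (k r : ℕ) (μ : Fin k → ℂ) (d : Fin r → ℂ) :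
    (fromBlocks (fromBlocks 1 (diagonal fun j => -(I * μ j)) (diagonal fun j => I * μ j) 1)
      0 0 (diagonal d) : Matrix ((Fin k ⊕ Fin k) ⊕ Fin r) ((Fin k ⊕ Fin k) ⊕ Fin r) ℂ) =
    fromBlocks (fromBlocks 1 0 (diagonal fun j => I * μ j) 1) 0 0 1 *
    diagonal (Sum.elim (Sum.elim (fun _ => 1) (fun j => 1 - μ j ^ 2)) d) *
    fromBlocks (fromBlocks 1 (diagonal fun j => -(I * μ j)) 0 1) 0 0 1 := by
  rw [← fromBlocks_diagonal, ← fromBlocks_diagonal]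
  simp only [fromBlocks_multiply, Matrix.mul_zero, Matrix.zero_mul, Matrix.mul_one,
    Matrix.one_mul, add_zero, zero_add, diagonal_mul_diagonal, diagonal_one, diagonal_add]
  congr 2
  rw [← diagonal_one]
  congr 1
  funext j
  linear_combination (μ j ^ 2) * I_sq

lemma nf_rank (k r : ℕ) (μ : Fin k → ℂ) (d : Fin r → ℂ) :
    (fromBlocks (fromBlocks 1 (diagonal fun j => -(I * μ j)) (diagonal fun j => I * μ j) 1)
      0 0 (diagonal d) : Matrix ((Fin k ⊕ Fin k) ⊕ Fin r) ((Fin k ⊕ Fin k) ⊕ Fin r) ℂ).rank =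
    k + Fintype.card {j // 1 - μ j ^ 2 ≠ 0} + Fintype.card {j // d j ≠ 0} := by
  rw [nf_factor, rank_mul_eq_left_of_isUnit_det, rank_mul_eq_right_of_isUnit_det, rank_diagonal]
  · simp only [Fintype.card_subtype, Finset.card_filter, Fintype.sum_sum_type, Sum.elim_inl,
      Sum.elim_inr]
    refine congrArg₂ _ (congrArg₂ _ (by simp) ?_) ?_
    · exact Finset.sum_congr rfl fun x _ => if_congr Iff.rfl rfl rfl
    · exact Finset.sum_congr rfl fun x _ => if_congr Iff.rfl rfl rfl
  · simp
  · simp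

lemma nf_count (k r a : ℕ) (h : k + k ≤ a) (h2 : a ≤ k + k + r) :
    Fintype.card {j : Fin r // (if k + k + (j : ℕ) < a then (1 : ℂ) else 0) ≠ 0} =
      a - (k + k) := by
  obtain ⟨t, rfl⟩ := Nat.exists_eq_add_of_le h
  have h3 : t ≤ r := by omega
  have : Fintype.card {j : Fin r // (if k + k + (j : ℕ) < k + k + t then (1 : ℂ) else 0) ≠ 0} =
      Fintype.card (Fin t) := by
    refine Fintype.card_congr ⟨fun j => ⟨j.1, ?_⟩, fun j => ⟨⟨j, by omega⟩, ?_⟩, ?_, ?_⟩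
    · have := j.2
      simpa using this
    · simp
    · intro j; rfl
    · intro j; rfl
  rw [this]; simp

lemma nf_count_mu (k : ℕ) (μ : Fin k → ℝ) (hμ : ∀ j, 0 < μ j ∧ μ j ≤ 1) :
    Fintype.card {j // 1 - (μ j : ℂ) ^ 2 ≠ 0} + Nat.card {j : Fin k // μ j = 1} = k := by
  classical
  have key : ∀ j, (1 - (μ j : ℂ) ^ 2 ≠ 0) ↔ ¬ (μ j = 1) := by
    intro j
    apply not_congr
    have := (hμ j).1
    constructor
    · intro h
      have h' : 1 - μ j ^ 2 = 0 := by exact_mod_cast h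
      nlinarith
    · intro h
      simp [h]
  rw [Nat.card_eq_fintype_card, Fintype.card_congr (Equiv.subtypeEquivRight key),
    Fintype.card_subtype_compl]
  have := Fintype.card_subtype_le (fun j : Fin k => μ j = 1)
  simp only [Fintype.card_fin] at *
  omega

/-- Let `A` be real symmetric PSD, `B` real skew-symmetric, with `A - iB`
positive semidefinite, and suppose an invertible congruence `C` brings `(A, B)` to the
normal forms `A' = diag(I_a, 0)` and `B'` with blocks `[[0, μ], [-μ, 0]]` padded by zeros
(`a = rank A`, `rank B = 2k`, `0 < μ_j ≤ 1`).  Then `rank(A - iB) = a - #₁(μ)` where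
`#₁(μ)` is the number of `μ_j` equal to `1`. -/
theorem rank_sub_i_smul_eq (m a k : ℕ) (A B C : Matrix (Fin m) (Fin m) ℝ) (μ : Fin k → ℝ)
    (hA : (A.map Complex.ofReal).PosSemidef)
    (hB : Bᵀ = -B)
    (hPSD : ((A.map Complex.ofReal) - Complex.I • (B.map Complex.ofReal)).PosSemidef)
    (hC : IsUnit C.det)
    (ha : (A.map Complex.ofReal).rank = a)
    (hb : (B.map Complex.ofReal).rank = 2 * k)
    (hka : 2 * k ≤ a) (ham : a ≤ m)
    (hμ : ∀ j, 0 < μ j ∧ μ j ≤ 1)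
    (hA' : C * A * Cᵀ = Matrix.of (fun i j : Fin m => if i = j ∧ (i : ℕ) < a then 1 else 0))
    (hB' : C * B * Cᵀ = Matrix.of (fun i j : Fin m =>
        if h1 : (j : ℕ) < 2 * k ∧ (j : ℕ) = (i : ℕ) + k then μ ⟨(i : ℕ), by omega⟩
        else if h2 : (i : ℕ) < 2 * k ∧ (i : ℕ) = (j : ℕ) + k then -(μ ⟨(j : ℕ), by omega⟩)
        else 0)) :
    ((A.map Complex.ofReal) - Complex.I • (B.map Complex.ofReal)).rank =
      a - Nat.card {j : Fin k // μ j = 1} := by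
  obtain ⟨r, rfl⟩ : ∃ r, m = k + k + r := ⟨m - (k + k), by omega⟩
  set M := (A.map Complex.ofReal) - Complex.I • (B.map Complex.ofReal) with hM
  have hCu : IsUnit (C.map Complex.ofReal).det := by
    have := hC.map Complex.ofRealHom
    rwa [RingHom.map_det] at this
  have hCu' : IsUnit ((C.map Complex.ofReal)ᵀ).det := by rwa [det_transpose]
  have hmap : ∀ X : Matrix (Fin (k + k + r)) (Fin (k + k + r)) ℝ,
      C.map Complex.ofReal * X.map Complex.ofReal * (C.map Complex.ofReal)ᵀ =
        (C * X * Cᵀ).map Complex.ofReal := by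
    intro X
    have h := Matrix.map_mul (L := C * X) (M := Cᵀ) (f := Complex.ofRealHom)
    rw [Matrix.map_mul (L := C) (M := X) (f := Complex.ofRealHom)] at h
    exact h.symm
  have h1 : M.rank = (C.map Complex.ofReal * M * (C.map Complex.ofReal)ᵀ).rank := by
    rw [rank_mul_eq_left_of_isUnit_det _ _ hCu', rank_mul_eq_right_of_isUnit_det _ _ hCu]
  have h2 : C.map Complex.ofReal * M * (C.map Complex.ofReal)ᵀ =
      (C * A * Cᵀ).map Complex.ofReal - Complex.I • (C * B * Cᵀ).map Complex.ofReal := by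
    rw [← hmap, ← hmap, hM, Matrix.mul_sub, Matrix.sub_mul, Matrix.mul_smul, Matrix.smul_mul]
  let e : (Fin k ⊕ Fin k) ⊕ Fin r ≃ Fin (k + k + r) :=
    (Equiv.sumCongr finSumFinEquiv (Equiv.refl _)).trans finSumFinEquiv
  have h3 : (C.map Complex.ofReal * M * (C.map Complex.ofReal)ᵀ).submatrix e e =
      fromBlocks (fromBlocks 1 (diagonal fun j => -(I * (μ j : ℂ)))
        (diagonal fun j => I * (μ j : ℂ)) 1) 0 0
        (diagonal fun j : Fin r => if k + k + (j : ℕ) < a then (1 : ℂ) else 0) := by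
    have e1 : ∀ x : Fin k, ((e (Sum.inl (Sum.inl x)) : Fin _) : ℕ) = x := by
      intro x; simp [e]
    have e2 : ∀ x : Fin k, ((e (Sum.inl (Sum.inr x)) : Fin _) : ℕ) = k + x := by
      intro x; simp [e, add_comm]
    have e3 : ∀ x : Fin r, ((e (Sum.inr x) : Fin _) : ℕ) = k + k + x := by
      intro x; simp [e]
    rw [h2, hA', hB']
    ext i j
    rcases i with (i | i) | i <;> rcases j with (j | j) | j <;>
      simp only [submatrix_apply, Matrix.sub_apply, Matrix.smul_apply, Matrix.map_apply, of_apply, e1, e2, e3,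
        fromBlocks_apply₁₁, fromBlocks_apply₁₂, fromBlocks_apply₂₁, fromBlocks_apply₂₂,
        diagonal_apply, one_apply, Matrix.zero_apply, Fin.ext_iff, smul_eq_mul]
    all_goals
      have hi := i.2
      have hj := j.2
      split_ifs <;> first
        | (exfalso; omega)
        | (simp; done)
        | (obtain rfl : i = j := Fin.ext (by omega)
           simp)
  have h4 : M.rank = k + Fintype.card {j // 1 - (μ j : ℂ) ^ 2 ≠ 0} +
      Fintype.card {j : Fin r // (if k + k + (j : ℕ) < a then (1 : ℂ) else 0) ≠ 0} := by
    rw [h1, ← rank_submatrix _ e e, h3, nf_rank]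
  have h5 := nf_count_mu k μ hμ
  rw [nf_count k r a (by omega) ham] at h4
  omega
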